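/- There is an absolute constant C > 0 such that for every ε ∈ (0,1) and every finite set P ⊆ ℝ² of n points, there exists an ε-well-separated pair decomposition of P consisting of at most C·ε⁻²·n pairs. -/

import Mathlib

/-- The distance between two sets of points: the infimum of pairwise distances. -/
noncomputable def setDist (U V : Set (EuclideanSpace ℝ (Fin 2))) : ℝ :=
  sInf (Set.image2 dist U V)

namespace QuadtreeWSPD

variable {α : Type*}

/-- The level-`k` ancestor of the integer grid cell `c p`. -/
def cell (c : α → ℤ × ℤ) (k : ℕ) (p : α) : ℤ × ℤ := ((c p).1 / 2 ^ k, (c p).2 / 2 ^ k)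

/-- Two grid cells are near if both of their coordinates differ by less than `M`. -/
def Near (M : ℤ) (a b : ℤ × ℤ) : Prop := |a.1 - b.1| < M ∧ |a.2 - b.2| < M

/-- The points of `P` lying in the level-`k` cell of `p`. -/
def cellPoints (P : Finset α) (c : α → ℤ × ℤ) (k : ℕ) (p : α) : Finset α :=
  P.filter fun q => cell c k q = cell c k p

theorem Near.symm {M : ℤ} {a b : ℤ × ℤ} (h : Near M a b) : Near M b a :=
  ⟨abs_sub_comm a.1 b.1 ▸ h.1, abs_sub_comm a.2 b.2 ▸ h.2⟩

theorem Near.refl {M : ℤ} (hM : 0 < M) (a : ℤ × ℤ) : Near M a a := by simp [Near, hM]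

theorem cell_succ (c : α → ℤ × ℤ) (k : ℕ) (p : α) :
    cell c (k + 1) p = ((cell c k p).1 / 2, (cell c k p).2 / 2) := by
  simp only [cell, pow_succ]
  rw [Int.ediv_ediv_of_nonneg (by positivity), Int.ediv_ediv_of_nonneg (by positivity)]

theorem cell_eq_of_le {c : α → ℤ × ℤ} {k l : ℕ} (hkl : k ≤ l) {p q : α}
    (h : cell c k p = cell c k q) : cell c l p = cell c l q := by
  induction l, hkl using Nat.le_induction with
  | base => exact h
  | succ l _ ih => rw [cell_succ, cell_succ, ih]

theorem near_cell_of_le {M : ℤ} {c : α → ℤ × ℤ} {k l : ℕ} (hkl : k ≤ l) {p q : α}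
    (h : Near M (cell c k p) (cell c k q)) : Near M (cell c l p) (cell c l q) := by
  induction l, hkl using Nat.le_induction with
  | base => exact h
  | succ l _ ih =>
    rw [cell_succ, cell_succ]
    simp only [Near, abs_lt] at ih ⊢
    omega

theorem exists_forall_near_cell {M : ℤ} (hM : 2 ≤ M) (P : Finset α) (c : α → ℤ × ℤ) :
    ∃ K, ∀ p ∈ P, ∀ q ∈ P, Near M (cell c K p) (cell c K q) := by
  have key : ∀ (K : ℕ) (x : ℤ), x.natAbs ≤ K → x / 2 ^ K = 0 ∨ x / 2 ^ K = -1 := by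
    intro K x hx
    have h2 : (K : ℤ) < 2 ^ K := by exact_mod_cast Nat.lt_two_pow_self
    have h1 : x / 2 ^ K < 1 := Int.ediv_lt_of_lt_mul (by positivity) (by omega)
    have h0 : -1 ≤ x / 2 ^ K := Int.le_ediv_of_mul_le (by positivity) (by omega)
    omega
  refine ⟨P.sup fun p => max (c p).1.natAbs (c p).2.natAbs, fun p hp q hq => ?_⟩
  have hle := fun r (hr : r ∈ P) =>
    Finset.le_sup (f := fun p => max (c p).1.natAbs (c p).2.natAbs) hr
  have hp1 := key _ _ ((le_max_left _ _).trans (hle p hp))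
  have hp2 := key _ _ ((le_max_right _ _).trans (hle p hp))
  have hq1 := key _ _ ((le_max_left _ _).trans (hle q hq))
  have hq2 := key _ _ ((le_max_right _ _).trans (hle q hq))
  simp only [Near, cell, abs_lt]
  omega

theorem mem_cellPoints {P : Finset α} {c : α → ℤ × ℤ} {k : ℕ} {p q : α} :
    q ∈ cellPoints P c k p ↔ q ∈ P ∧ cell c k q = cell c k p := by
  simp [cellPoints]

theorem self_mem_cellPoints {P : Finset α} {c : α → ℤ × ℤ} {k : ℕ} {p : α} (hp : p ∈ P) :
    p ∈ cellPoints P c k p := mem_cellPoints.2 ⟨hp, rfl⟩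

theorem cellPoints_congr {P : Finset α} {c : α → ℤ × ℤ} {k : ℕ} {p q : α}
    (h : cell c k p = cell c k q) : cellPoints P c k p = cellPoints P c k q := by
  simp [cellPoints, h]

theorem cellPoints_eq_of_mem {P : Finset α} {c : α → ℤ × ℤ} {k : ℕ} {p q : α}
    (h : q ∈ cellPoints P c k p) : cellPoints P c k q = cellPoints P c k p :=
  cellPoints_congr (mem_cellPoints.1 h).2

theorem cellPoints_mono (P : Finset α) (c : α → ℤ × ℤ) {k l : ℕ} (hkl : k ≤ l) (p : α) :
    cellPoints P c k p ⊆ cellPoints P c l p := fun _ hq =>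
  mem_cellPoints.2 ⟨(mem_cellPoints.1 hq).1, cell_eq_of_le hkl (mem_cellPoints.1 hq).2⟩

theorem cellPoints_eq_of_between {P : Finset α} {c : α → ℤ × ℤ} {k j l : ℕ} (hkj : k ≤ j)
    (hjl : j ≤ l) {p q : α} (hp : p ∈ P) (h : cellPoints P c k p = cellPoints P c l q) :
    cellPoints P c j p = cellPoints P c k p := by
  refine (cellPoints_mono P c hkj p).antisymm' ?_
  have hpq : p ∈ cellPoints P c l q := h ▸ self_mem_cellPoints hp
  rw [h, ← cellPoints_eq_of_mem hpq]
  exact cellPoints_mono P c hjl p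

/-- The sets of points of `P` in the level-`k` cells. -/
noncomputable def level (P : Finset α) (c : α → ℤ × ℤ) (k : ℕ) : Finset (Finset α) := by
  classical exact P.image (cellPoints P c k)

theorem mem_level {P : Finset α} {c : α → ℤ × ℤ} {k : ℕ} {S : Finset α} :
    S ∈ level P c k ↔ ∃ p ∈ P, cellPoints P c k p = S := by
  simp [level]

open Classical in
theorem card_new_add_card_level_succ_le (P : Finset α) (c : α → ℤ × ℤ) (k : ℕ) :
    (level P c (k + 1) \ level P c k).card + (level P c (k + 1)).card ≤ (level P c k).card := by
  have hmaps : ∀ S ∈ level P c k, P.filter (fun q => ∃ p ∈ S, cell c (k + 1) q = cell c (k + 1) p)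
      ∈ level P c (k + 1) := by
    intro S hS
    obtain ⟨p, hp, rfl⟩ := mem_level.1 hS
    refine mem_level.2 ⟨p, hp, ?_⟩
    ext q
    simp only [mem_cellPoints, Finset.mem_filter]
    refine and_congr_right fun hq => ⟨fun h => ⟨p, ⟨hp, rfl⟩, h⟩, ?_⟩
    rintro ⟨r, ⟨-, hr⟩, h⟩
    exact h.trans (cell_eq_of_le k.le_succ hr)
  have himage : ∀ p ∈ P, P.filter (fun q => ∃ r ∈ cellPoints P c k p,
      cell c (k + 1) q = cell c (k + 1) r) = cellPoints P c (k + 1) p := by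
    intro p hp
    ext q
    simp only [mem_cellPoints, Finset.mem_filter]
    refine and_congr_right fun hq => ⟨?_, fun h => ⟨p, ⟨hp, rfl⟩, h⟩⟩
    rintro ⟨r, ⟨-, hr⟩, h⟩
    exact h.trans (cell_eq_of_le k.le_succ hr)
  rw [Finset.card_eq_sum_card_fiberwise hmaps, Finset.card_eq_sum_ones (level P c (k + 1)),
    ← Finset.filter_notMem_eq_sdiff, Finset.card_filter, ← Finset.sum_add_distrib]
  refine Finset.sum_le_sum fun T hT => ?_
  obtain ⟨p, hp, rfl⟩ := mem_level.1 hT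
  have hpF : cellPoints P c k p ∈ (level P c k).filter (fun S => P.filter (fun q => ∃ r ∈ S,
      cell c (k + 1) q = cell c (k + 1) r) = cellPoints P c (k + 1) p) :=
    Finset.mem_filter.2 ⟨mem_level.2 ⟨p, hp, rfl⟩, himage p hp⟩
  by_cases hnew : cellPoints P c (k + 1) p ∈ level P c k
  · rw [if_neg (not_not.2 hnew), zero_add]
    exact Finset.card_pos.2 ⟨_, hpF⟩
  · rw [if_pos hnew]
    have hne : cellPoints P c k p ≠ cellPoints P c (k + 1) p := fun h =>
      hnew (mem_level.2 ⟨p, hp, h⟩)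
    obtain ⟨q, hq, hqp⟩ := Finset.exists_of_ssubset
      ((cellPoints_mono P c k.le_succ p).ssubset_of_ne hne)
    have hqP := (mem_cellPoints.1 hq).1
    refine Finset.one_lt_card.2 ⟨_, hpF, cellPoints P c k q, Finset.mem_filter.2
      ⟨mem_level.2 ⟨q, hqP, rfl⟩, (himage q hqP).trans (cellPoints_eq_of_mem hq)⟩, ?_⟩
    intro h
    exact hqp (h ▸ self_mem_cellPoints hqP)

open Classical in
theorem card_biUnion_level_le (P : Finset α) (c : α → ℤ × ℤ) (K : ℕ) :
    ((Finset.range (K + 1)).biUnion (level P c)).card ≤ 2 * P.card := by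
  suffices h : ((Finset.range (K + 1)).biUnion (level P c)).card + (level P c K).card
      ≤ 2 * P.card by omega
  induction K with
  | zero =>
    have : (level P c 0).card ≤ P.card := by
      rw [level]; convert Finset.card_image_le
    simp only [zero_add, Finset.range_one, Finset.singleton_biUnion]
    omega
  | succ K ih =>
    have hsub : (Finset.range (K + 1 + 1)).biUnion (level P c) ⊆
        (Finset.range (K + 1)).biUnion (level P c) ∪ (level P c (K + 1) \ level P c K) := by
      intro S hS
      rw [Finset.range_add_one, Finset.biUnion_insert, Finset.mem_union] at hS
      by_cases hK : S ∈ level P c K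
      · exact Finset.mem_union_left _ (Finset.mem_biUnion.2 ⟨K, by simp, hK⟩)
      · rcases hS with hS | hS
        · exact Finset.mem_union_right _ (Finset.mem_sdiff.2 ⟨hS, hK⟩)
        · exact Finset.mem_union_left _ hS
    have h1 := (Finset.card_le_card hsub).trans (Finset.card_union_le _ _)
    have h2 := card_new_add_card_level_succ_le P c K
    omega

/-- `S` and `T` are cells of some level that are not near, while their parents are. -/
def Splits (P : Finset α) (c : α → ℤ × ℤ) (M : ℤ) (S T : Finset α) : Prop :=
  ∃ k, ∃ p ∈ P, ∃ q ∈ P, S = cellPoints P c k p ∧ T = cellPoints P c k q ∧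
    ¬ Near M (cell c k p) (cell c k q) ∧ Near M (cell c (k + 1) p) (cell c (k + 1) q)

theorem Splits.symm {P : Finset α} {c : α → ℤ × ℤ} {M : ℤ} {S T : Finset α}
    (h : Splits P c M S T) : Splits P c M T S := by
  obtain ⟨k, p, hp, q, hq, hS, hT, hn, hn'⟩ := h
  exact ⟨k, q, hq, p, hp, hT, hS, fun h => hn h.symm, hn'.symm⟩

theorem Splits.disjoint {P : Finset α} {c : α → ℤ × ℤ} {M : ℤ} (hM : 0 < M) {S T : Finset α}
    (h : Splits P c M S T) : Disjoint S T := by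
  obtain ⟨k, p, hp, q, hq, rfl, rfl, hn, -⟩ := h
  refine Finset.disjoint_left.2 fun r hr hr' => hn ?_
  rw [← (mem_cellPoints.1 hr).2, ← (mem_cellPoints.1 hr').2]
  exact Near.refl hM _

theorem exists_splits {P : Finset α} {c : α → ℤ × ℤ} {M : ℤ} (hM : 2 ≤ M) {p q : α}
    (hp : p ∈ P) (hq : q ∈ P) (h0 : ¬ Near M (cell c 0 p) (cell c 0 q)) :
    ∃ S T, Splits P c M S T ∧ p ∈ S ∧ q ∈ T := by
  classical
  have hex : ∃ k, Near M (cell c k p) (cell c k q) :=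
    (exists_forall_near_cell hM P c).imp fun K hK => hK p hp q hq
  obtain ⟨k, hk⟩ : ∃ k, Nat.find hex = k + 1 :=
    Nat.exists_eq_succ_of_ne_zero fun h => h0 (h ▸ Nat.find_spec hex)
  exact ⟨_, _, ⟨k, p, hp, q, hq, rfl, rfl, Nat.find_min hex (by omega), hk ▸ Nat.find_spec hex⟩,
    self_mem_cellPoints hp, self_mem_cellPoints hq⟩

theorem Splits.unique {P : Finset α} {c : α → ℤ × ℤ} {M : ℤ} {S T S' T' : Finset α}
    (h : Splits P c M S T) (h' : Splits P c M S' T') {p q : α} (hp : p ∈ S) (hq : q ∈ T)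
    (hp' : p ∈ S') (hq' : q ∈ T') : S = S' ∧ T = T' := by
  obtain ⟨k, a, -, b, -, rfl, rfl, hn, hn'⟩ := h
  obtain ⟨l, a', -, b', -, rfl, rfl, hl, hl'⟩ := h'
  have ha := (mem_cellPoints.1 hp).2
  have hb := (mem_cellPoints.1 hq).2
  have ha' := (mem_cellPoints.1 hp').2
  have hb' := (mem_cellPoints.1 hq').2
  rw [← cell_eq_of_le k.le_succ ha, ← cell_eq_of_le k.le_succ hb] at hn'
  rw [← cell_eq_of_le l.le_succ ha', ← cell_eq_of_le l.le_succ hb'] at hl'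
  rw [← ha, ← hb] at hn
  rw [← ha', ← hb'] at hl
  have hkl : k = l := by
    by_contra hne
    rcases Nat.lt_or_gt_of_ne hne with h | h
    · exact hl (near_cell_of_le h hn')
    · exact hn (near_cell_of_le h hl')
  subst hkl
  exact ⟨cellPoints_congr (ha.symm.trans ha'), cellPoints_congr (hb.symm.trans hb')⟩

open Classical in
/-- The highest level up to `K` in which `S` is a cell. -/
noncomputable def topLevel (P : Finset α) (c : α → ℤ × ℤ) (K : ℕ) (S : Finset α) : ℕ :=
  Nat.findGreatest (fun k => S ∈ level P c k) K

theorem mem_level_topLevel {P : Finset α} {c : α → ℤ × ℤ} {K k : ℕ} {S : Finset α} (hk : k ≤ K)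
    (hS : S ∈ level P c k) : S ∈ level P c (topLevel P c K S) := by
  classical
  exact Nat.findGreatest_spec (P := fun k => S ∈ level P c k) hk hS

theorem le_topLevel {P : Finset α} {c : α → ℤ × ℤ} {K k : ℕ} {S : Finset α} (hk : k ≤ K)
    (hS : S ∈ level P c k) : k ≤ topLevel P c K S := by
  classical
  exact Nat.le_findGreatest hk hS

theorem near_cell_of_near_cell_succ {M : ℤ} {c : α → ℤ × ℤ} {k d : ℕ} (hkd : k ≤ d)
    {p q : α} (h : Near M (cell c (k + 1) p) (cell c (k + 1) q)) :
    Near (2 * M + 1) (cell c d p) (cell c d q) := by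
  refine near_cell_of_le hkd ?_
  rw [cell_succ, cell_succ] at h
  simp only [Near, abs_lt] at h ⊢
  omega

open Classical in
/-- A cell splits from at most `(4 M + 1) ^ 2` cells that survive at least as long. -/
theorem card_splits_partners_le {P : Finset α} {c : α → ℤ × ℤ} {M : ℤ} (hM : 0 < M) {K : ℕ}
    (hK : ∀ p ∈ P, ∀ q ∈ P, Near M (cell c K p) (cell c K q)) (S : Finset α)
    (A : Finset (Finset α))
    (hA : ∀ T ∈ A, Splits P c M S T ∧ topLevel P c K S ≤ topLevel P c K T) :
    A.card ≤ ((4 * M + 1) ^ 2).toNat := by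
  rcases A.eq_empty_or_nonempty with rfl | ⟨T₀, hT₀⟩
  · simp
  obtain ⟨k₀, s, hs, -, -, hSs, -⟩ := (hA T₀ hT₀).1
  have hsS : s ∈ S := hSs ▸ self_mem_cellPoints hs
  set d := topLevel P c K S
  have key : ∀ T ∈ A, ∃ q ∈ P, T = cellPoints P c d q ∧
      Near (2 * M + 1) (cell c d s) (cell c d q) := by
    intro T hT
    obtain ⟨⟨k, p, hp, q, hq, hS, rfl, hn, hn'⟩, hle⟩ := hA T hT
    have hkK : k ≤ K := by
      by_contra h
      exact hn (near_cell_of_le (by omega) (hK p hp q hq))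
    have hkd : k ≤ d := le_topLevel hkK (mem_level.2 ⟨p, hp, hS.symm⟩)
    obtain ⟨r, hr, hrT⟩ := mem_level.1 (mem_level_topLevel hkK (mem_level.2 ⟨q, hq, rfl⟩))
    refine ⟨q, hq, (cellPoints_eq_of_between hkd hle hq hrT.symm).symm, ?_⟩
    rw [cell_eq_of_le hkd (mem_cellPoints.1 (hS ▸ hsS)).2]
    exact near_cell_of_near_cell_succ hkd hn'
  have : Nonempty α := ⟨s⟩
  choose! f hfP hfT hfN using key
  set a := cell c d s
  have hbox : A.card ≤ (Finset.Icc (a.1 - 2 * M) (a.1 + 2 * M) ×ˢ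
      Finset.Icc (a.2 - 2 * M) (a.2 + 2 * M)).card := by
    refine Finset.card_le_card_of_injOn (fun T => cell c d (f T)) (fun T hT => ?_) ?_
    · have := hfN T hT
      simp only [Near, abs_lt] at this
      simp only [Finset.coe_product, Finset.coe_Icc, Set.mem_prod, Set.mem_Icc]
      omega
    · intro T hT T' hT' h
      rw [hfT T hT, hfT T' hT']
      exact cellPoints_congr h
  refine hbox.trans_eq ?_
  rw [Finset.card_product, Int.card_Icc, Int.card_Icc, sq, Int.toNat_mul (by omega) (by omega)]
  ring_nf

open Classical in
theorem exists_decomposition {M : ℤ} (hM : 2 ≤ M) (P : Finset α) (c : α → ℤ × ℤ)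
    (h0 : ∀ p ∈ P, ∀ q ∈ P, p ≠ q → ¬ Near M (cell c 0 p) (cell c 0 q)) :
    ∃ D : Finset (Finset α × Finset α), (∀ d ∈ D, Splits P c M d.1 d.2) ∧
      (∀ p ∈ P, ∀ q ∈ P, p ≠ q →
        ∃! d, d ∈ D ∧ ((p ∈ d.1 ∧ q ∈ d.2) ∨ (p ∈ d.2 ∧ q ∈ d.1))) ∧
      D.card ≤ 2 * (((4 * M + 1) ^ 2).toNat * (2 * P.card)) := by
  obtain ⟨K, hK⟩ := exists_forall_near_cell hM P c
  set cells := (Finset.range (K + 1)).biUnion (level P c)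
  have hmem : ∀ {S T}, Splits P c M S T → S ∈ cells := by
    rintro S T ⟨k, p, hp, q, hq, hS, -, hn, -⟩
    have hkK : k ≤ K := by
      by_contra h
      exact hn (near_cell_of_le (by omega) (hK p hp q hq))
    exact Finset.mem_biUnion.2 ⟨k, by simp; omega, mem_level.2 ⟨p, hp, hS.symm⟩⟩
  set W := (cells ×ˢ cells).filter fun d => Splits P c M d.1 d.2 ∧
    topLevel P c K d.1 ≤ topLevel P c K d.2
  have hWcard : W.card ≤ ((4 * M + 1) ^ 2).toNat * (2 * P.card) := by
    have himg : W.image Prod.fst ⊆ cells := fun S hS => by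
      obtain ⟨d, hd, rfl⟩ := Finset.mem_image.1 hS
      exact hmem (Finset.mem_filter.1 hd).2.1
    refine (Finset.card_le_mul_card_image (f := Prod.fst) W ((4 * M + 1) ^ 2).toNat
      fun S _ => ?_).trans (Nat.mul_le_mul_left _
        ((Finset.card_le_card himg).trans (card_biUnion_level_le P c K)))
    rw [← Finset.card_image_of_injOn (f := Prod.snd)]
    · refine card_splits_partners_le (by omega) hK S _ fun T hT => ?_
      obtain ⟨d, hd, rfl⟩ := Finset.mem_image.1 hT
      obtain ⟨hdW, rfl⟩ := Finset.mem_filter.1 hd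
      exact (Finset.mem_filter.1 hdW).2
    · intro d hd d' hd' h
      exact Prod.ext ((Finset.mem_filter.1 hd).2.trans (Finset.mem_filter.1 hd').2.symm) h
  refine ⟨(cells ×ˢ cells).filter fun d => Splits P c M d.1 d.2 ∧ WellOrderingRel d.1 d.2,
    fun d hd => (Finset.mem_filter.1 hd).2.1, fun p hp q hq hpq => ?_, ?_⟩
  · obtain ⟨S, T, hST, hpS, hqT⟩ := exists_splits hM hp hq (h0 p hp q hq hpq)
    have hne : S ≠ T := by
      rintro rfl
      exact Finset.disjoint_left.1 (hST.disjoint (by omega)) hpS hpS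
    have hasymm : ∀ {A B : Finset α}, WellOrderingRel A B → ¬ WellOrderingRel B A :=
      fun h h' => asymm h h'
    have hmemD : ∀ {A B}, Splits P c M A B → (A, B) ∈ cells ×ˢ cells := fun h =>
      Finset.mem_product.2 ⟨hmem h, hmem h.symm⟩
    have huniq : ∀ A B, Splits P c M A B → (p ∈ A ∧ q ∈ B) ∨ (p ∈ B ∧ q ∈ A) →
        (A = S ∧ B = T) ∨ (A = T ∧ B = S) := by
      rintro A B hAB (⟨hA, hB⟩ | ⟨hB, hA⟩)
      · exact .inl (hAB.unique hST hA hB hpS hqT)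
      · exact .inr (hAB.symm.unique hST hB hA hpS hqT).symm
    rcases trichotomous_of WellOrderingRel S T with h | h | h
    · refine ⟨(S, T), ⟨Finset.mem_filter.2 ⟨hmemD hST, hST, h⟩, .inl ⟨hpS, hqT⟩⟩, ?_⟩
      rintro ⟨A, B⟩ ⟨hAB, hpq'⟩
      obtain ⟨-, hAB, hlt⟩ := Finset.mem_filter.1 hAB
      rcases huniq A B hAB hpq' with ⟨rfl, rfl⟩ | ⟨rfl, rfl⟩
      · rfl
      · exact absurd hlt (hasymm h)
    · exact absurd h hne
    · refine ⟨(T, S), ⟨Finset.mem_filter.2 ⟨hmemD hST.symm, hST.symm, h⟩, .inr ⟨hpS, hqT⟩⟩, ?_⟩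
      rintro ⟨A, B⟩ ⟨hAB, hpq'⟩
      obtain ⟨-, hAB, hlt⟩ := Finset.mem_filter.1 hAB
      rcases huniq A B hAB hpq' with ⟨rfl, rfl⟩ | ⟨rfl, rfl⟩
      · exact absurd hlt (hasymm h)
      · rfl
  · have hsub : ((cells ×ˢ cells).filter fun d => Splits P c M d.1 d.2 ∧
        WellOrderingRel d.1 d.2) ⊆ W ∪ W.image Prod.swap := by
      intro d hd
      obtain ⟨hd, hs, -⟩ := Finset.mem_filter.1 hd
      rcases le_total (topLevel P c K d.1) (topLevel P c K d.2) with h | h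
      · exact Finset.mem_union_left _ (Finset.mem_filter.2 ⟨hd, hs, h⟩)
      · exact Finset.mem_union_right _ (Finset.mem_image.2 ⟨d.swap, Finset.mem_filter.2
          ⟨Finset.mem_product.2 (Finset.mem_product.1 hd).symm, hs.symm, h⟩, d.swap_swap⟩)
    have h1 := (Finset.card_le_card hsub).trans (Finset.card_union_le _ _)
    have h2 : (W.image Prod.swap).card ≤ W.card := Finset.card_image_le
    omega

theorem abs_sub_lt_of_abs_floor_div_sub_lt {t : ℝ} (ht : 0 < t) {a b : ℝ} {M : ℤ}
    (h : |⌊a / t⌋ - ⌊b / t⌋| < M) : |a - b| < M * t := by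
  have hM : (|⌊a / t⌋ - ⌊b / t⌋| : ℝ) ≤ M - 1 := by exact_mod_cast Int.le_sub_one_of_lt h
  rw [abs_le] at hM
  have ha1 := Int.floor_le (a / t)
  have ha2 := Int.lt_floor_add_one (a / t)
  have hb1 := Int.floor_le (b / t)
  have hb2 := Int.lt_floor_add_one (b / t)
  have h' : |a / t - b / t| < M := abs_lt.2 ⟨by linarith, by linarith⟩
  rwa [← sub_div, abs_div, abs_of_pos ht, div_lt_iff₀ ht] at h'

theorem mul_le_abs_sub_of_le_abs_floor_div_sub {t : ℝ} (ht : 0 < t) {a b : ℝ} {M : ℤ}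
    (h : M ≤ |⌊a / t⌋ - ⌊b / t⌋|) : (M - 1) * t ≤ |a - b| := by
  have hM : (M : ℝ) ≤ |(⌊a / t⌋ : ℝ) - ⌊b / t⌋| := by exact_mod_cast h
  have ha1 := Int.floor_le (a / t)
  have ha2 := Int.lt_floor_add_one (a / t)
  have hb1 := Int.floor_le (b / t)
  have hb2 := Int.lt_floor_add_one (b / t)
  have h' : (M : ℝ) - 1 ≤ |a / t - b / t| := by
    rcases le_abs.1 hM with h | h
    · exact le_abs.2 (.inl (by linarith))
    · exact le_abs.2 (.inr (by linarith))
  rwa [← sub_div, abs_div, abs_of_pos ht, le_div_iff₀ ht] at h'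

theorem dist_le_abs_add_abs (p q : EuclideanSpace ℝ (Fin 2)) :
    dist p q ≤ |p 0 - q 0| + |p 1 - q 1| := by
  rw [EuclideanSpace.dist_eq, Fin.sum_univ_two, Real.dist_eq, Real.dist_eq]
  refine Real.sqrt_le_iff.2 ⟨by positivity, ?_⟩
  nlinarith [abs_nonneg (p 0 - q 0), abs_nonneg (p 1 - q 1)]

theorem abs_sub_apply_le_dist (p q : EuclideanSpace ℝ (Fin 2)) (i : Fin 2) :
    |p i - q i| ≤ dist p q := by
  rw [dist_eq_norm]
  exact PiLp.norm_apply_le (p - q) i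

/-- The cell of side length `s` containing `p`. -/
noncomputable def gridCell (s : ℝ) (p : EuclideanSpace ℝ (Fin 2)) : ℤ × ℤ :=
  (⌊p 0 / s⌋, ⌊p 1 / s⌋)

theorem cell_gridCell (s : ℝ) (k : ℕ) (p : EuclideanSpace ℝ (Fin 2)) :
    cell (gridCell s) k p = gridCell (s * 2 ^ k) p := by
  have key : ∀ a : ℝ, ⌊a / s⌋ / 2 ^ k = ⌊a / (s * 2 ^ k)⌋ := fun a => by
    have := Int.floor_div_natCast (a / s) (2 ^ k)
    rw [← div_div]
    push_cast at this
    exact this.symm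
  simp only [cell, gridCell, key]

theorem dist_lt_of_near_gridCell {t : ℝ} (ht : 0 < t) {M : ℤ} {p q : EuclideanSpace ℝ (Fin 2)}
    (h : Near M (gridCell t p) (gridCell t q)) : dist p q < 2 * M * t := by
  have h1 := abs_sub_lt_of_abs_floor_div_sub_lt ht h.1
  have h2 := abs_sub_lt_of_abs_floor_div_sub_lt ht h.2
  linarith [dist_le_abs_add_abs p q]

theorem le_dist_of_not_near_gridCell {t : ℝ} (ht : 0 < t) {M : ℤ}
    {p q : EuclideanSpace ℝ (Fin 2)} (h : ¬ Near M (gridCell t p) (gridCell t q)) :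
    (M - 1) * t ≤ dist p q := by
  rw [Near, not_and_or, not_lt, not_lt] at h
  rcases h with h | h
  · exact (mul_le_abs_sub_of_le_abs_floor_div_sub ht h).trans (abs_sub_apply_le_dist p q 0)
  · exact (mul_le_abs_sub_of_le_abs_floor_div_sub ht h).trans (abs_sub_apply_le_dist p q 1)

theorem Splits.nonempty {P : Finset α} {c : α → ℤ × ℤ} {M : ℤ} {S T : Finset α}
    (h : Splits P c M S T) : S.Nonempty := by
  obtain ⟨k, p, hp, -, -, rfl, -⟩ := h
  exact ⟨p, self_mem_cellPoints hp⟩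

theorem Splits.subset {P : Finset α} {c : α → ℤ × ℤ} {M : ℤ} {S T : Finset α}
    (h : Splits P c M S T) : S ⊆ P := by
  obtain ⟨k, p, -, -, -, rfl, -⟩ := h
  exact Finset.filter_subset _ _

theorem Splits.wellSeparated {P : Finset (EuclideanSpace ℝ (Fin 2))} {s ε : ℝ} (hs : 0 < s)
    (hε : 0 < ε) {M : ℤ} (hM : 2 ≤ ε * (M - 1)) {S T : Finset (EuclideanSpace ℝ (Fin 2))}
    (h : Splits P (gridCell s) M S T) :
    max (Metric.diam (S : Set (EuclideanSpace ℝ (Fin 2)))) (Metric.diam (T : Set (EuclideanSpace ℝ (Fin 2))))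
      ≤ ε * setDist S T := by
  have hne := h.nonempty
  have hne' := h.symm.nonempty
  obtain ⟨k, p, hp, q, hq, rfl, rfl, hn, -⟩ := h
  have ht : 0 < s * 2 ^ k := by positivity
  have hdiam : ∀ r, Metric.diam (cellPoints P (gridCell s) k r :
      Set (EuclideanSpace ℝ (Fin 2))) ≤ 2 * (s * 2 ^ k) := fun r => by
    refine Metric.diam_le_of_forall_dist_le (by positivity) fun a ha b hb => ?_
    have hab := (mem_cellPoints.1 ha).2.trans (mem_cellPoints.1 hb).2.symm
    rw [cell_gridCell, cell_gridCell] at hab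
    have hnear : Near 1 (gridCell (s * 2 ^ k) a) (gridCell (s * 2 ^ k) b) := by
      rw [hab]
      exact Near.refl one_pos _
    have := dist_lt_of_near_gridCell ht hnear
    push_cast at this
    linarith
  have hdist : (M - 1) * (s * 2 ^ k) ≤ setDist (cellPoints P (gridCell s) k p)
      (cellPoints P (gridCell s) k q) := by
    refine le_csInf (Set.Nonempty.image2 (by exact_mod_cast hne) (by exact_mod_cast hne')) ?_
    rintro _ ⟨a, ha, b, hb, rfl⟩
    rw [← (mem_cellPoints.1 ha).2, ← (mem_cellPoints.1 hb).2, cell_gridCell, cell_gridCell] at hn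
    exact le_dist_of_not_near_gridCell ht hn
  refine (max_le (hdiam p) (hdiam q)).trans ?_
  calc 2 * (s * 2 ^ k) ≤ ε * (M - 1) * (s * 2 ^ k) := by gcongr
    _ = ε * ((M - 1) * (s * 2 ^ k)) := by ring
    _ ≤ _ := by gcongr

theorem exists_pos_le_dist {X : Type*} [MetricSpace X] (P : Finset X) :
    ∃ δ : ℝ, 0 < δ ∧ ∀ p ∈ P, ∀ q ∈ P, p ≠ q → δ ≤ dist p q := by
  classical
  rcases P.offDiag.eq_empty_or_nonempty with h | h
  · refine ⟨1, one_pos, fun p hp q hq hpq => ?_⟩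
    have : (p, q) ∈ P.offDiag := Finset.mem_offDiag.2 ⟨hp, hq, hpq⟩
    simp [h] at this
  · obtain ⟨a, ha, hmin⟩ := P.offDiag.exists_min_image (fun a => dist a.1 a.2) h
    exact ⟨_, dist_pos.2 (Finset.mem_offDiag.1 ha).2.2, fun p hp q hq hpq =>
      hmin (p, q) (Finset.mem_offDiag.2 ⟨hp, hq, hpq⟩)⟩

end QuadtreeWSPD

/-- There is an absolute constant `C > 0` such that for every `ε ∈ (0,1)` and every finite
set `P ⊆ ℝ²` of `n` points, there exists an `ε`-well-separated pair decomposition of `P`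
consisting of at most `C · ε⁻² · n` pairs. -/
theorem wspd_exists :
    ∃ C : ℝ, 0 < C ∧
      ∀ ε : ℝ, 0 < ε → ε < 1 →
        ∀ P : Finset (EuclideanSpace ℝ (Fin 2)),
          ∃ (m : ℕ)
            (F : Fin m → Set (EuclideanSpace ℝ (Fin 2)) × Set (EuclideanSpace ℝ (Fin 2))),
            (∀ i : Fin m,
                (F i).1 ⊆ ↑P ∧ (F i).2 ⊆ ↑P ∧
                (F i).1.Nonempty ∧ (F i).2.Nonempty ∧
                (F i).1 ∩ (F i).2 = ∅ ∧
                max (Metric.diam (F i).1) (Metric.diam (F i).2)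
                  ≤ ε * setDist (F i).1 (F i).2) ∧
            (∀ p ∈ P, ∀ q ∈ P, p ≠ q →
                ∃! i : Fin m,
                  (p ∈ (F i).1 ∧ q ∈ (F i).2) ∨ (p ∈ (F i).2 ∧ q ∈ (F i).1)) ∧
            (m : ℝ) ≤ C * ε⁻¹ ^ 2 * P.card := by
  refine ⟨4 * 17 ^ 2, by norm_num, fun ε hε hε1 P => ?_⟩
  have hinv : 1 < ε⁻¹ := (one_lt_inv₀ hε).2 hε1
  set M : ℤ := ⌈2 * ε⁻¹⌉ + 1 with hMdef
  have hMlow : 2 * ε⁻¹ ≤ (M : ℝ) - 1 := by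
    rw [hMdef]; push_cast; linarith [Int.le_ceil (2 * ε⁻¹)]
  have hMup : (M : ℝ) ≤ 2 * ε⁻¹ + 2 := by
    rw [hMdef]; push_cast; linarith [Int.ceil_lt_add_one (2 * ε⁻¹)]
  have hM2 : 2 ≤ M := by
    have : (2 : ℝ) ≤ M := by linarith
    exact_mod_cast this
  have hMpos : (0 : ℝ) < M := by linarith
  have hsep : 2 ≤ ε * (M - 1) := by
    calc (2 : ℝ) = ε * (2 * ε⁻¹) := by field_simp
      _ ≤ _ := by gcongr
  obtain ⟨δ, hδ, hP⟩ := QuadtreeWSPD.exists_pos_le_dist P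
  have hs : 0 < δ / (2 * M) := by positivity
  obtain ⟨D, hD, hcover, hcard⟩ := QuadtreeWSPD.exists_decomposition hM2 P
    (QuadtreeWSPD.gridCell (δ / (2 * M))) fun p hp q hq hpq hn => by
      rw [QuadtreeWSPD.cell_gridCell, QuadtreeWSPD.cell_gridCell, pow_zero, mul_one] at hn
      have := QuadtreeWSPD.dist_lt_of_near_gridCell hs hn
      rw [mul_div_cancel₀ _ (by positivity)] at this
      exact (hP p hp q hq hpq).not_gt this
  refine ⟨D.card, fun i => (((D.equivFin.symm i).1.1 : Set _), ((D.equivFin.symm i).1.2 : Set _)),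
    fun i => ?_, fun p hp q hq hpq => ?_, ?_⟩
  · have h := hD _ (D.equivFin.symm i).2
    refine ⟨by exact_mod_cast h.subset, by exact_mod_cast h.symm.subset,
      by exact_mod_cast h.nonempty, by exact_mod_cast h.symm.nonempty, ?_,
      h.wellSeparated hs hε hsep⟩
    exact (Finset.disjoint_coe.2 (h.disjoint (by omega))).inter_eq
  · obtain ⟨d, ⟨hdD, hd⟩, huniq⟩ := hcover p hp q hq hpq
    refine ⟨D.equivFin ⟨d, hdD⟩, by simpa using hd, fun i hi => ?_⟩
    rw [← Equiv.symm_apply_eq]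
    exact Subtype.ext (huniq _ ⟨(D.equivFin.symm i).2, hi⟩)
  · have hnat : ((((4 * M + 1) ^ 2).toNat : ℕ) : ℝ) = (4 * M + 1) ^ 2 := by
      have : ((((4 * M + 1) ^ 2).toNat : ℕ) : ℤ) = (4 * M + 1) ^ 2 :=
        Int.toNat_of_nonneg (by positivity)
      exact_mod_cast this
    calc (D.card : ℝ) ≤ 2 * ((4 * M + 1) ^ 2 * (2 * P.card)) := by
          rw [← hnat]; exact_mod_cast hcard
      _ ≤ 2 * ((17 * ε⁻¹) ^ 2 * (2 * P.card)) := by gcongr; linarith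
      _ = 4 * 17 ^ 2 * ε⁻¹ ^ 2 * P.card := by ring
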